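/- Suppose Assumption 2 holds. Let τ > 0 and q, x₀ ∈ B_op(R₂). Assume that the ODE ẋ_q(t) = f_q(x_q(t)) with x_q(0) = q has a solution x_q on [0,τ), and the ODE ẋ(t) = f(x(t), g(q)) with x(0) = x₀ has a solution x on [0,τ). If x_q(t), x(t) ∈ B_op(R₂) for all t ∈ [0,τ), then ‖x(t) − q‖_op ≤ e^{d₁t}‖x₀ − q‖_op + ‖x_q(t) − q‖_op for all t ∈ [0,τ). -/

import Mathlib

set_option autoImplicit false

open Filter Set MeasureTheory Real
open scoped Topology ENNReal

noncomputable section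

/-- `N` is a norm on `ℝ^n`. -/
structure IsVecNorm {n : ℕ} (N : (Fin n → ℝ) → ℝ) : Prop where
  eq_zero : ∀ x, N x = 0 ↔ x = 0
  smul_eq : ∀ (a : ℝ) (x : Fin n → ℝ), N (a • x) = |a| * N x
  add_le : ∀ x y : Fin n → ℝ, N (x + y) ≤ N x + N y

/-- The matrix norm induced by the vector norm `N`. -/
def matNorm {n : ℕ} (N : (Fin n → ℝ) → ℝ) (A : Matrix (Fin n) (Fin n) ℝ) : ℝ :=
  sSup {c : ℝ | ∃ x : Fin n → ℝ, N x = 1 ∧ c = N (A.mulVec x)}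

/-- The logarithmic norm `μ_N(A) = lim_{ε→0⁺} (‖I+εA‖_N − 1)/ε`. -/
def logNorm {n : ℕ} (N : (Fin n → ℝ) → ℝ) (A : Matrix (Fin n) (Fin n) ℝ) : ℝ :=
  limUnder (𝓝[>] (0 : ℝ)) (fun ε : ℝ => (matNorm N (1 + ε • A) - 1) / ε)

/-- The Jacobian matrix of `F` at `x`. -/
def jacobian {n : ℕ} (F : (Fin n → ℝ) → (Fin n → ℝ)) (x : Fin n → ℝ) :
    Matrix (Fin n) (Fin n) ℝ :=
  Matrix.of fun i j => fderiv ℝ F x (Pi.single j 1) i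

/-- Open ball of radius `r` centered at `0` w.r.t. the norm `N`. -/
def nball {n : ℕ} (N : (Fin n → ℝ) → ℝ) (r : ℝ) : Set (Fin n → ℝ) := {x | N x < r}

/-- `ν(t) = d₂ ∫₀ᵗ e^{d₁ s} ds`. -/
def nu (d₁ d₂ t : ℝ) : ℝ := d₂ * ∫ s in (0:ℝ)..t, Real.exp (d₁ * s)

/-- Diagonally-weighted r-norm `‖x‖_{r,[θ]} = ‖[θ]x‖_r`. -/
def wnorm {n : ℕ} (r : ℝ≥0∞) (θ x : Fin n → ℝ) : ℝ :=
  ‖(WithLp.equiv r (∀ _ : Fin n, ℝ)).symm (fun i => θ i * x i)‖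


namespace IsVecNorm

variable {n : ℕ} {N : (Fin n → ℝ) → ℝ}

lemma zero' (h : IsVecNorm N) : N 0 = 0 := (h.eq_zero 0).2 rfl

lemma neg' (h : IsVecNorm N) (x) : N (-x) = N x := by
  have := h.smul_eq (-1) x
  simpa using this

lemma nonneg' (h : IsVecNorm N) (x) : 0 ≤ N x := by
  have := h.add_le x (-x)
  rw [h.neg', add_neg_cancel, h.zero'] at this
  linarith

lemma smul_pos' (h : IsVecNorm N) {c : ℝ} (hc : 0 ≤ c) (x) : N (c • x) = c * N x := by
  rw [h.smul_eq, abs_of_nonneg hc]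

lemma convexOn' (h : IsVecNorm N) : ConvexOn ℝ univ N := by
  refine ⟨convex_univ, fun x _ y _ a b ha hb _ => ?_⟩
  have := h.add_le (a • x) (b • y)
  rwa [h.smul_pos' ha, h.smul_pos' hb] at this

lemma cont (h : IsVecNorm N) : Continuous N :=
  h.convexOn'.locallyLipschitz.continuous

lemma lower (h : IsVecNorm N) : ∃ c > 0, ∀ x, c * ‖x‖ ≤ N x := by
  rcases (Metric.sphere (0 : Fin n → ℝ) 1).eq_empty_or_nonempty with he | hne
  · refine ⟨1, one_pos, fun x => ?_⟩
    by_cases hx : x = 0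
    · subst hx; simp [h.zero']
    · exfalso
      have : ‖x‖⁻¹ • x ∈ Metric.sphere (0 : Fin n → ℝ) 1 := by
        simp [norm_smul, norm_ne_zero_iff.2 hx]
      rw [he] at this
      exact this
  · obtain ⟨z, hz, hmin⟩ := (isCompact_sphere (0 : Fin n → ℝ) 1).exists_isMinOn hne h.cont.continuousOn
    have hz0 : z ≠ 0 := by
      rintro rfl
      simp at hz
    refine ⟨N z, lt_of_le_of_ne (h.nonneg' z) (fun e => hz0 ((h.eq_zero z).1 e.symm)), fun x => ?_⟩
    by_cases hx : x = 0
    · subst hx; simp [h.zero']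
    · have h1 : ‖x‖⁻¹ • x ∈ Metric.sphere (0 : Fin n → ℝ) 1 := by
        simp [norm_smul, norm_ne_zero_iff.2 hx]
      have h2 : N z ≤ N (‖x‖⁻¹ • x) := hmin h1
      have hp : 0 < ‖x‖ := norm_pos_iff.2 hx
      rw [h.smul_pos' (by positivity), inv_mul_eq_div, le_div_iff₀ hp] at h2
      exact h2

lemma bdd (h : IsVecNorm N) (A : Matrix (Fin n) (Fin n) ℝ) :
    BddAbove {c : ℝ | ∃ x : Fin n → ℝ, N x = 1 ∧ c = N (A.mulVec x)} := by
  obtain ⟨c, hc, hl⟩ := h.lower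
  have hcomp : IsCompact (Metric.closedBall (0 : Fin n → ℝ) c⁻¹) := isCompact_closedBall _ _
  have hcont : Continuous fun x : Fin n → ℝ => N (A.mulVec x) :=
    h.cont.comp (Continuous.matrix_mulVec continuous_const continuous_id)
  refine (hcomp.bddAbove_image hcont.continuousOn).mono ?_
  rintro _ ⟨x, hx, rfl⟩
  refine ⟨x, ?_, rfl⟩
  have := hl x
  rw [mem_closedBall_zero_iff, ← one_div, le_div_iff₀ hc]
  linarith

lemma le_matNorm (h : IsVecNorm N) (A : Matrix (Fin n) (Fin n) ℝ) {x} (hx : N x = 1) :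
    N (A.mulVec x) ≤ matNorm N A := le_csSup (h.bdd A) ⟨x, hx, rfl⟩

lemma matNorm_mono (h : IsVecNorm N) (A : Matrix (Fin n) (Fin n) ℝ) {u} (hu : N u = 1) :
    MonotoneOn (fun ε : ℝ => (matNorm N (1 + ε • A) - 1) / ε) (Ioi 0) := by
  intro a ha b hb hab
  have ha' : 0 < a := ha
  have hb' : 0 < b := hb
  have key : matNorm N (1 + a • A) ≤ (1 - a / b) + (a / b) * matNorm N (1 + b • A) := by
    refine csSup_le ⟨_, u, hu, rfl⟩ ?_
    rintro _ ⟨x, hx, rfl⟩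
    have hab1 : a / b ≤ 1 := (div_le_one hb').2 hab
    have e : (1 + a • A).mulVec x = (1 - a / b) • x + (a / b) • ((1 + b • A).mulVec x) := by
      have : a / b * b = a := by field_simp
      simp only [Matrix.add_mulVec, Matrix.one_mulVec, Matrix.smul_mulVec, smul_add, smul_smul, this]
      module
    rw [e]
    refine (h.add_le _ _).trans ?_
    rw [h.smul_pos' (by linarith), h.smul_pos' (by positivity), hx, mul_one]
    gcongr
    exact h.le_matNorm _ hx
  show (matNorm N (1 + a • A) - 1) / a ≤ (matNorm N (1 + b • A) - 1) / b
  rw [div_le_div_iff₀ ha' hb']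
  have : b * ((1 - a / b) + (a / b) * matNorm N (1 + b • A)) = b - a + a * matNorm N (1 + b • A) := by
    field_simp
  nlinarith [mul_le_mul_of_nonneg_left key hb'.le]

lemma supp_le_logNorm_unit (h : IsVecNorm N) (A : Matrix (Fin n) (Fin n) ℝ) {u} (hu : N u = 1)
    (l : (Fin n → ℝ) →ₗ[ℝ] ℝ) (hl : ∀ x, l x ≤ N x) (hlu : l u = N u) :
    l (A.mulVec u) ≤ logNorm N A := by
  have hlow : ∀ ε ∈ Ioi (0 : ℝ), l (A.mulVec u) ≤ (matNorm N (1 + ε • A) - 1) / ε := by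
    intro ε hε
    have hε' : 0 < ε := hε
    rw [le_div_iff₀ hε']
    have h1 := (hl ((1 + ε • A).mulVec u)).trans (h.le_matNorm _ hu)
    simp only [Matrix.add_mulVec, Matrix.one_mulVec, Matrix.smul_mulVec, map_add, map_smul,
      smul_eq_mul, hlu, hu] at h1
    linarith
  have ht := (h.matNorm_mono A hu).tendsto_nhdsGT
    ⟨l (A.mulVec u), by rintro _ ⟨ε, hε, rfl⟩; exact hlow ε hε⟩
  have h2 : logNorm N A = _ := ht.limUnder_eq
  rw [h2]
  exact ge_of_tendsto ht (eventually_nhdsWithin_of_forall hlow)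

lemma supp_le_logNorm (h : IsVecNorm N) (A : Matrix (Fin n) (Fin n) ℝ) {u} (hu : u ≠ 0)
    (l : (Fin n → ℝ) →ₗ[ℝ] ℝ) (hl : ∀ x, l x ≤ N x) (hlu : l u = N u) :
    l (A.mulVec u) ≤ logNorm N A * N u := by
  have hp : 0 < N u := lt_of_le_of_ne (h.nonneg' u) (fun e => hu ((h.eq_zero u).1 e.symm))
  have := h.supp_le_logNorm_unit A (u := (N u)⁻¹ • u)
    (by rw [h.smul_pos' (by positivity)]; field_simp) l hl
    (by rw [h.smul_pos' (by positivity), map_smul, hlu]; rfl)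
  rw [Matrix.mulVec_smul, map_smul, smul_eq_mul, inv_mul_eq_div, div_le_iff₀ hp] at this
  exact this

lemma exists_supp (h : IsVecNorm N) (u : Fin n → ℝ) :
    ∃ l : (Fin n → ℝ) →ₗ[ℝ] ℝ, (∀ x, l x ≤ N x) ∧ l u = N u := by
  by_cases hu : u = 0
  · subst hu
    exact ⟨0, fun x => by simpa using h.nonneg' x, by simp [h.zero']⟩
  obtain ⟨l, h1, h2⟩ := exists_extension_of_le_sublinear
    (LinearPMap.mkSpanSingleton (σ := RingHom.id ℝ) u (N u) hu) N (fun c hc x => h.smul_pos' hc.le x) h.add_le (by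
      rintro ⟨x, hx⟩
      obtain ⟨c, rfl⟩ := Submodule.mem_span_singleton.1 hx
      erw [LinearPMap.mkSpanSingleton'_apply]
      show c * N u ≤ N (c • u)
      rw [h.smul_eq]
      exact mul_le_mul_of_nonneg_right (le_abs_self c) (h.nonneg' u))
  refine ⟨l, h2, ?_⟩
  have := h1 ⟨u, Submodule.mem_span_singleton_self u⟩
  rw [LinearPMap.mkSpanSingleton_apply] at this
  exact this

lemma isOpen_nball (h : IsVecNorm N) (R : ℝ) : IsOpen (nball N R) :=
  isOpen_lt h.cont continuous_const

lemma convex_nball (h : IsVecNorm N) (R : ℝ) : Convex ℝ (nball N R) := by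
  have := h.convexOn'.convex_lt R
  simpa [nball] using this

end IsVecNorm

lemma jacobian_mulVec' {n : ℕ} (F : (Fin n → ℝ) → (Fin n → ℝ)) (x u : Fin n → ℝ) :
    (jacobian F x).mulVec u = fderiv ℝ F x u := by
  have : jacobian F x = LinearMap.toMatrix' (fderiv ℝ F x : (Fin n → ℝ) →ₗ[ℝ] (Fin n → ℝ)) := by
    ext i j
    simp [jacobian, LinearMap.toMatrix'_apply, Pi.single_apply]
  rw [this, LinearMap.toMatrix'_mulVec]
  rfl

lemma one_sided {n : ℕ} {N : (Fin n → ℝ) → ℝ} (h : IsVecNorm N) {R d : ℝ}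
    (F : (Fin n → ℝ) → (Fin n → ℝ)) (hF : ContDiffOn ℝ 1 F (nball N R))
    (hmu : ∀ x ∈ nball N R, logNorm N (jacobian F x) ≤ d)
    {x y : Fin n → ℝ} (hx : x ∈ nball N R) (hy : y ∈ nball N R)
    (l : (Fin n → ℝ) →ₗ[ℝ] ℝ) (hl : ∀ x, l x ≤ N x) (hlu : l (x - y) = N (x - y)) :
    l (F x - F y) ≤ d * N (x - y) := by
  by_cases hxy : x - y = 0
  · rw [sub_eq_zero] at hxy
    subst hxy
    simp [h.zero']
  set L : (Fin n → ℝ) →L[ℝ] ℝ := LinearMap.toContinuousLinearMap l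
  have hmem : ∀ s ∈ Icc (0 : ℝ) 1, y + s • (x - y) ∈ nball N R := fun s hs =>
    (h.convex_nball R).add_smul_sub_mem hy hx hs
  have hd : ∀ s ∈ Icc (0 : ℝ) 1, HasDerivAt (fun s : ℝ => L (F (y + s • (x - y))))
      (L (fderiv ℝ F (y + s • (x - y)) (x - y))) s := by
    intro s hs
    have h1 : HasFDerivAt F (fderiv ℝ F (y + s • (x - y))) (y + s • (x - y)) :=
      ((hF.contDiffAt ((h.isOpen_nball R).mem_nhds (hmem s hs))).differentiableAt
        (by simp)).hasFDerivAt
    have h2 : HasDerivAt (fun s : ℝ => y + s • (x - y)) (x - y) s := by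
      simpa using ((hasDerivAt_id s).smul_const (x - y)).const_add y
    exact L.hasFDerivAt.comp_hasDerivAt s (h1.comp_hasDerivAt s h2)
  obtain ⟨c, hc, he⟩ := exists_hasDerivAt_eq_slope _ _ (zero_lt_one' ℝ)
    (fun s hs => (hd s hs).continuousAt.continuousWithinAt)
    (fun s hs => hd s (Ioo_subset_Icc_self hs))
  have h3 := h.supp_le_logNorm (jacobian F (y + c • (x - y))) hxy l hl hlu
  rw [jacobian_mulVec'] at h3
  have h4 := hmu _ (hmem c (Ioo_subset_Icc_self hc))
  have h5 := mul_le_mul_of_nonneg_right h4 (h.nonneg' (x - y))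
  have h6 : l (F x - F y) = l (fderiv ℝ F (y + c • (x - y)) (x - y)) := by
    have : l (fderiv ℝ F (y + c • (x - y)) (x - y)) = _ := he
    rw [this]
    simp [L]
  linarith

lemma contraction {n : ℕ} {N : (Fin n → ℝ) → ℝ} (h : IsVecNorm N) {R d τ : ℝ}
    (F : (Fin n → ℝ) → (Fin n → ℝ)) (hF : ContDiffOn ℝ 1 F (nball N R))
    (hmu : ∀ x ∈ nball N R, logNorm N (jacobian F x) ≤ d)
    (x y : ℝ → (Fin n → ℝ))
    (hx : ∀ t ∈ Ico (0:ℝ) τ, HasDerivWithinAt x (F (x t)) (Ico 0 τ) t)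
    (hy : ∀ t ∈ Ico (0:ℝ) τ, HasDerivWithinAt y (F (y t)) (Ico 0 τ) t)
    (hxB : ∀ t ∈ Ico (0:ℝ) τ, x t ∈ nball N R)
    (hyB : ∀ t ∈ Ico (0:ℝ) τ, y t ∈ nball N R) {T : ℝ} (hT : T ∈ Ico (0:ℝ) τ) :
    N (x T - y T) ≤ Real.exp (d * T) * N (x 0 - y 0) := by
  set D : ℝ → (Fin n → ℝ) := fun t => Real.exp (-d * t) • (x t - y t) with hD
  have hDc : ContinuousOn D (Icc 0 T) := by
    have hs : Icc 0 T ⊆ Ico 0 τ := fun s hs => ⟨hs.1, hs.2.trans_lt hT.2⟩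
    have h1 : ContinuousOn x (Icc 0 T) := fun s hs' => (hx s (hs hs')).continuousWithinAt.mono hs
    have h2 : ContinuousOn y (Icc 0 T) := fun s hs' => (hy s (hs hs')).continuousWithinAt.mono hs
    exact (by fun_prop : ContinuousOn (fun t => Real.exp (-d * t)) (Icc 0 T)).smul (h1.sub h2)
  have hDd : ∀ t ∈ Ioc 0 T, HasDerivAt D (Real.exp (-d * t) • (F (x t) - F (y t)) +
      (Real.exp (-d * t) * (-d)) • (x t - y t)) t := by
    intro t ht
    have hm : t ∈ Ico 0 τ := ⟨ht.1.le, ht.2.trans_lt hT.2⟩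
    have hn : Ico 0 τ ∈ 𝓝 t := Ico_mem_nhds ht.1 hm.2
    have h1 := (hx t hm).hasDerivAt hn
    have h2 := (hy t hm).hasDerivAt hn
    have h3 : HasDerivAt (fun t => Real.exp (-d * t)) (Real.exp (-d * t) * (-d)) t := by
      simpa using ((hasDerivAt_id t).const_mul (-d)).exp
    exact h3.smul (h1.sub h2)
  have main := image_le_of_liminf_slope_right_le_deriv_boundary (f := fun s => -N (D (T - s)))
    (a := 0) (b := T) (B := fun _ => -N (D T)) (B' := fun _ => 0)
    (by
      refine (h.cont.comp_continuousOn (hDc.comp (by fun_prop) ?_)).neg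
      intro s hs
      exact ⟨by linarith [hs.2], by linarith [hs.1]⟩)
    (by simp) continuousOn_const (fun s _ => hasDerivWithinAt_const _ _ _)
    (by
      intro s hs r hr
      have hts : T - s ∈ Ioc 0 T := ⟨by linarith [hs.2], by linarith [hs.1]⟩
      have htm : T - s ∈ Ico 0 τ := ⟨hts.1.le, hts.2.trans_lt hT.2⟩
      obtain ⟨l, hl, hlu⟩ := h.exists_supp (x (T - s) - y (T - s))
      set L : (Fin n → ℝ) →L[ℝ] ℝ := LinearMap.toContinuousLinearMap l
      have hos := one_sided h F hF hmu (hxB _ htm) (hyB _ htm) l hl hlu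
      have hlD : L (D (T - s)) = N (D (T - s)) := by
        show l _ = _
        simp only [hD]
        rw [map_smul, hlu, h.smul_pos' (Real.exp_pos _).le, smul_eq_mul]
      have hder : HasDerivAt (fun s => - L (D (T - s)))
          (L (Real.exp (-d * (T - s)) • (F (x (T - s)) - F (y (T - s))) +
      (Real.exp (-d * (T - s)) * (-d)) • (x (T - s) - y (T - s)))) s := by
        have h1 := (hDd _ hts).scomp s ((hasDerivAt_id s).const_sub T)
        have h2 := (L.hasFDerivAt.comp_hasDerivAt s h1).neg
        refine h2.congr_deriv ?_
        rw [neg_one_smul, map_neg, neg_neg]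
      have hle : L (Real.exp (-d * (T - s)) • (F (x (T - s)) - F (y (T - s))) +
          (Real.exp (-d * (T - s)) * (-d)) • (x (T - s) - y (T - s))) ≤ 0 := by
        show l _ ≤ 0
        rw [map_add, map_smul, map_smul, hlu, smul_eq_mul, smul_eq_mul]
        nlinarith [mul_le_mul_of_nonneg_left hos (Real.exp_pos (-d * (T - s))).le]
      have hsl := hder.hasDerivWithinAt (s := Ioi s)
      rw [hasDerivWithinAt_iff_tendsto_slope' (by simp)] at hsl
      have hev := hsl.eventually_lt_const (hle.trans_lt hr)
      refine Eventually.frequently ?_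
      filter_upwards [hev, self_mem_nhdsWithin] with z hz hsz
      refine lt_of_le_of_lt ?_ hz
      have hsz' : 0 < z - s := sub_pos.2 hsz
      rw [slope_def_field, slope_def_field, hlD]
      have : L (D (T - z)) ≤ N (D (T - z)) := hl _
      gcongr)
  have h0 := main (x := T) ⟨hT.1, le_rfl⟩
  simp only [sub_self, hD, mul_zero, Real.exp_zero, one_smul] at h0
  rw [h.smul_pos' (Real.exp_pos _).le] at h0
  have h1 : Real.exp (d * T) * Real.exp (-d * T) = 1 := by
    rw [← Real.exp_add]; simp
  nlinarith [mul_le_mul_of_nonneg_left h0 (Real.exp_pos (d * T)).le, congrArg (· * N (x T - y T)) h1]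

theorem stmt2
    {n m : ℕ} (hn : 0 < n) (hm : 0 < m)
    (f : (Fin n → ℝ) → (Fin m → ℝ) → (Fin n → ℝ)) (g : (Fin n → ℝ) → (Fin m → ℝ))
    (hf : Continuous (fun p : (Fin n → ℝ) × (Fin m → ℝ) => f p.1 p.2)) (hg : Continuous g)
    (hf0 : f 0 (g 0) = 0)
    -- Assumption 2
    (Nop : (Fin n → ℝ) → ℝ) (hNop : IsVecNorm Nop) (d₁ d₂ R₂ : ℝ)
    (hd₁ : 0 ≤ d₁) (hd₂ : 0 < d₂) (hR₂ : 0 < R₂)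
    (hC1 : ∀ q ∈ nball Nop R₂, ContDiffOn ℝ 1 (fun x => f x (g q)) (nball Nop R₂))
    (hmuop : ∀ q ∈ nball Nop R₂, ∀ x ∈ nball Nop R₂,
      logNorm Nop (jacobian (fun y => f y (g q)) x) ≤ d₁)
    (hfqq : ∀ q ∈ nball Nop R₂, Nop (f q (g q)) ≤ d₂ * Nop q)
    (τ : ℝ) (hτ : 0 < τ) (q x₀ : Fin n → ℝ)
    (hq : q ∈ nball Nop R₂) (hx₀ : x₀ ∈ nball Nop R₂)
    (xq x : ℝ → (Fin n → ℝ)) (hxq0 : xq 0 = q) (hx0 : x 0 = x₀)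
    (hodeq : ∀ t ∈ Ico (0:ℝ) τ, HasDerivWithinAt xq (f (xq t) (g q)) (Ico 0 τ) t)
    (hode : ∀ t ∈ Ico (0:ℝ) τ, HasDerivWithinAt x (f (x t) (g q)) (Ico 0 τ) t)
    (hxqB : ∀ t ∈ Ico (0:ℝ) τ, xq t ∈ nball Nop R₂)
    (hxB : ∀ t ∈ Ico (0:ℝ) τ, x t ∈ nball Nop R₂) :
    ∀ t ∈ Ico (0:ℝ) τ,
      Nop (x t - q) ≤ Real.exp (d₁ * t) * Nop (x₀ - q) + Nop (xq t - q) := by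
  intro t ht
  have h1 := contraction hNop (fun y => f y (g q)) (hC1 q hq) (hmuop q hq) x xq hode hodeq hxB hxqB ht
  rw [hx0, hxq0] at h1
  have h2 := hNop.add_le (x t - xq t) (xq t - q)
  rw [sub_add_sub_cancel] at h2
  linarith

end
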